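/- arXiv:2412.01779 — 2 statements merged into one kernel-verified Lean document; each statement's English description precedes it below -/
import Mathlib

section
/- Let f : V_V → W be an ℓ-times Fréchet differentiable map, for some ℓ ≥ 1, on an open subset V_V of a normed vector space V with values in a normed vector space W. Then for every v_0 ∈ V_V, the ℓ-th differential satisfies ‖D^ℓ f(v_0)‖^{L^ℓ(V^ℓ;W)} ≤ sup{ ‖T^ℓ f(v̲)‖^{T^ℓ_• W} : v̲ ∈ T^ℓ V_V with base point v_0 and ‖v̲‖^{T^ℓ_• V} ≤ 1 }. -/
noncomputable section

universe u v

/-- The iterated tangent space `T^ℓ V = V^{2^ℓ}`, defined recursively by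
`T^0 V = V` and `T^{ℓ+1} V = T^ℓ V × T^ℓ V`. -/
def Tang (V : Type u) : ℕ → Type u
  | 0 => V
  | n + 1 => Tang V n × Tang V n

noncomputable instance Tang.instNormedAddCommGroup (V : Type u) [NormedAddCommGroup V] :
    ∀ n, NormedAddCommGroup (Tang V n)
  | 0 => inferInstanceAs (NormedAddCommGroup V)
  | n + 1 =>
    letI := Tang.instNormedAddCommGroup V n
    inferInstanceAs (NormedAddCommGroup (Tang V n × Tang V n))

noncomputable instance Tang.instNormedSpace (V : Type u) [NormedAddCommGroup V]
    [NormedSpace ℝ V] : ∀ n, NormedSpace ℝ (Tang V n)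
  | 0 => inferInstanceAs (NormedSpace ℝ V)
  | n + 1 =>
    letI := Tang.instNormedSpace V n
    inferInstanceAs (NormedSpace ℝ (Tang V n × Tang V n))

/-- The base point `v₀` of a higher tangent vector. -/
def Tang.base {V : Type u} : ∀ n, Tang V n → V
  | 0, v => v
  | n + 1, p => Tang.base n p.1

/-- The fiber norm `‖(v₀, v₁, …, v_N)‖^{T^ℓ_• V} = max {‖v₁‖, …, ‖v_N‖}`: the maximum of
the norms of all entries except the base point. -/
noncomputable def Tang.fiberNorm {V : Type u} [NormedAddCommGroup V] :
    ∀ n, Tang V n → ℝ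
  | 0, _ => 0
  | n + 1, p => max (Tang.fiberNorm n p.1) ‖p.2‖

/-- The iterated tangent map `T^ℓ f`, defined recursively by `T^0 f = f` and
`T^{ℓ+1} f (p, q) = (T^ℓ f p, D(T^ℓ f)(p) q)`. -/
noncomputable def TMap {V : Type u} {W : Type v} [NormedAddCommGroup V] [NormedSpace ℝ V]
    [NormedAddCommGroup W] [NormedSpace ℝ W] (f : V → W) :
    ∀ n, Tang V n → Tang W n
  | 0 => f
  | n + 1 => fun p => (TMap f n p.1, fderiv ℝ (TMap f n) p.1 p.2)

theorem Tang.base_add_aux {V : Type u} [NormedAddCommGroup V] [NormedSpace ℝ V] (n : ℕ) :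
    ∃ L : Tang V n →L[ℝ] V, ∀ p, L p = Tang.base n p := by
  induction n with
  | zero => exact ⟨ContinuousLinearMap.id ℝ V, fun p => rfl⟩
  | succ n ih =>
    obtain ⟨L, hL⟩ := ih
    exact ⟨L.comp (ContinuousLinearMap.fst ℝ (Tang V n) (Tang V n)), fun p => hL p.1⟩

/-- The base point, as a continuous linear map. -/
def Tang.baseL (V : Type u) [NormedAddCommGroup V] [NormedSpace ℝ V] (n : ℕ) :
    Tang V n →L[ℝ] V := (Tang.base_add_aux n).choose

theorem Tang.baseL_apply {V : Type u} [NormedAddCommGroup V] [NormedSpace ℝ V] (n : ℕ)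
    (p : Tang V n) : Tang.baseL V n p = Tang.base n p := (Tang.base_add_aux n).choose_spec p

/-- The last component. -/
def Tang.last (V : Type u) [NormedAddCommGroup V] [NormedSpace ℝ V] :
    ∀ n, Tang V n →L[ℝ] V
  | 0 => ContinuousLinearMap.id ℝ V
  | n + 1 => (Tang.last V n).comp (ContinuousLinearMap.snd ℝ (Tang V n) (Tang V n))

/-- Inclusion at the base point. -/
def Tang.incl (V : Type u) [NormedAddCommGroup V] [NormedSpace ℝ V] :
    ∀ n, V →L[ℝ] Tang V n
  | 0 => ContinuousLinearMap.id ℝ V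
  | n + 1 => (ContinuousLinearMap.inl ℝ (Tang V n) (Tang V n)).comp (Tang.incl V n)

/-- The test vector. -/
def Tang.tv {V : Type u} [NormedAddCommGroup V] [NormedSpace ℝ V] :
    ∀ n, V → (Fin n → V) → Tang V n
  | 0, x, _ => x
  | n + 1, x, w => (Tang.tv n x (Fin.tail w), Tang.incl V n (w 0))

section aux
variable {V : Type u} {W : Type v}
    [NormedAddCommGroup V] [NormedSpace ℝ V] [NormedAddCommGroup W] [NormedSpace ℝ W]

theorem Tang.norm_last_le : ∀ (n : ℕ) (p : Tang V n), ‖Tang.last V n p‖ ≤ ‖p‖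
  | 0, p => le_refl _
  | n + 1, p => (Tang.norm_last_le n p.2).trans (le_max_right ‖p.1‖ ‖p.2‖)

theorem Tang.norm_incl_le : ∀ (n : ℕ) (v : V), ‖Tang.incl V n v‖ ≤ ‖v‖
  | 0, v => le_refl _
  | n + 1, v => by
    refine max_le (Tang.norm_incl_le n v) ?_
    change ‖(0 : Tang V n)‖ ≤ ‖v‖
    simp

theorem Tang.base_tv : ∀ (n : ℕ) (x : V) (w : Fin n → V), Tang.base n (Tang.tv n x w) = x
  | 0, _, _ => rfl
  | n + 1, x, w => Tang.base_tv n x (Fin.tail w)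

theorem Tang.fiberNorm_tv : ∀ (n : ℕ) (x : V) (w : Fin n → V), (∀ i, ‖w i‖ ≤ 1) →
    Tang.fiberNorm n (Tang.tv n x w) ≤ 1
  | 0, _, _, _ => zero_le_one
  | n + 1, x, w, h => max_le (Tang.fiberNorm_tv n x (Fin.tail w) fun i => h i.succ)
      ((Tang.norm_incl_le n (w 0)).trans (h 0))

theorem Tang.tv_eq : ∀ (n : ℕ) (x : V) (w : Fin n → V),
    Tang.tv n x w = Tang.tv n 0 w + Tang.incl V n x
  | 0, x, _ => (zero_add x).symm
  | n + 1, x, w => Prod.ext (Tang.tv_eq n x (Fin.tail w)) (add_zero _).symm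

theorem Tang.hasFDerivAt_tv (n : ℕ) (x : V) (w : Fin n → V) :
    HasFDerivAt (fun y => Tang.tv n y w) (Tang.incl V n) x := by
  have : (fun y => Tang.tv n y w) = fun y => Tang.tv n 0 w + Tang.incl V n y :=
    funext fun y => Tang.tv_eq n y w
  rw [this]
  exact (Tang.incl V n).hasFDerivAt.const_add _

variable (V W) in
/-- Space of jets. -/
abbrev Jt (n : ℕ) := (k : Fin (n + 1)) → (V [×(k : ℕ)]→L[ℝ] W)

/-- The jet of a map. -/
def jet (f : V → W) (n : ℕ) (x : V) : Jt V W n := fun k => iteratedFDeriv ℝ (k : ℕ) f x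

/-- Truncation of jets. -/
def jtrunc (n : ℕ) (j : Jt V W (n + 1)) : Jt V W n := fun k => j k.castSucc

/-- Shift of jets. -/
def jshift (n : ℕ) (j : Jt V W (n + 1)) (v : V) : Jt V W n :=
  fun k => (continuousMultilinearCurryLeftEquiv ℝ (fun _ : Fin ((k : ℕ) + 1) => V) W (j k.succ)) v

theorem contDiff_jtrunc (n : ℕ) : ContDiff ℝ (⊤ : ℕ∞) (jtrunc (V := V) (W := W) n) := by
  refine contDiff_pi.2 fun k => ?_
  exact (ContinuousLinearMap.proj (R := ℝ)
    (φ := fun k : Fin (n + 1 + 1) => (V [×(k : ℕ)]→L[ℝ] W)) k.castSucc).contDiff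

theorem contDiff_jshift (n : ℕ) :
    ContDiff ℝ (⊤ : ℕ∞) (fun p : Jt V W (n + 1) × V => jshift n p.1 p.2) := by
  refine contDiff_pi.2 fun k => ?_
  have h1 : ContDiff ℝ (⊤ : ℕ∞) (fun p : Jt V W (n + 1) × V => p.1 k.succ) :=
    (ContinuousLinearMap.proj (R := ℝ)
      (φ := fun k : Fin (n + 1 + 1) => (V [×(k : ℕ)]→L[ℝ] W)) k.succ).contDiff.comp contDiff_fst
  exact ((continuousMultilinearCurryLeftEquiv ℝ
    (fun _ : Fin ((k : ℕ) + 1) => V) W).toContinuousLinearEquiv.contDiff.comp h1).clm_apply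
      contDiff_snd

theorem hasFDerivAt_jet (f : V → W) (n : ℕ) (x : V)
    (h : ∀ k ≤ n, DifferentiableAt ℝ (iteratedFDeriv ℝ k f) x) :
    ∃ L : V →L[ℝ] Jt V W n, HasFDerivAt (jet f n) L x ∧
      ∀ v, L v = jshift n (jet f (n + 1) x) v := by
  refine ⟨ContinuousLinearMap.pi fun k => fderiv ℝ (iteratedFDeriv ℝ (k : ℕ) f) x, ?_, ?_⟩
  · exact hasFDerivAt_pi.2 fun k => (h k (Nat.lt_succ_iff.1 k.2)).hasFDerivAt
  · intro v
    funext k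
    ext m
    simp only [jshift, jet, ContinuousLinearMap.coe_pi']
    rw [fderiv_iteratedFDeriv]
    rfl

theorem TMap_jet (f : V → W) (U : Set V) (hU : IsOpen U) (n : ℕ) 
    (h : ∀ k < n, ∀ x ∈ U, DifferentiableAt ℝ (iteratedFDeriv ℝ k f) x) :
    ∃ Φ : Jt V W n × Tang V n → Tang W n, ContDiff ℝ (⊤ : ℕ∞) Φ ∧
      ∀ p, Tang.baseL V n p ∈ U → TMap f n p = Φ (jet f n (Tang.baseL V n p), p) := by
  induction n with
  | zero =>
    refine ⟨fun q => (continuousMultilinearCurryFin0 ℝ V W) (q.1 0), ?_, ?_⟩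
    · have h1 : ContDiff ℝ (⊤ : ℕ∞) (fun p : Jt V W 0 × Tang V 0 => p.1 0) :=
        (ContinuousLinearMap.proj (R := ℝ)
          (φ := fun k : Fin (0 + 1) => (V [×(k : ℕ)]→L[ℝ] W)) 0).contDiff.comp contDiff_fst
      exact (continuousMultilinearCurryFin0 ℝ V W).toContinuousLinearEquiv.contDiff.comp h1
    · intro p _
      rw [Tang.baseL_apply]
      rfl
  | succ n ih =>
    obtain ⟨Φ, hΦ, hf⟩ := ih fun k hk => h k (by omega)
    have hb : ContDiff ℝ (⊤ : ℕ∞) (Tang.baseL V n) := (Tang.baseL V n).contDiff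
    let pr1 : Tang V (n + 1) →L[ℝ] Tang V n := ContinuousLinearMap.fst ℝ (Tang V n) (Tang V n)
    let pr2 : Tang V (n + 1) →L[ℝ] Tang V n := ContinuousLinearMap.snd ℝ (Tang V n) (Tang V n)
    have hp1 : ContDiff ℝ (⊤ : ℕ∞) (fun z : Jt V W (n + 1) × Tang V (n + 1) => pr1 z.2) :=
      pr1.contDiff.comp contDiff_snd
    have hp2 : ContDiff ℝ (⊤ : ℕ∞) (fun z : Jt V W (n + 1) × Tang V (n + 1) => pr2 z.2) :=
      pr2.contDiff.comp contDiff_snd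
    have hj : ContDiff ℝ (⊤ : ℕ∞) (fun z : Jt V W (n + 1) × Tang V (n + 1) =>
        (jtrunc n z.1, pr1 z.2)) := ((contDiff_jtrunc n).comp contDiff_fst).prodMk hp1
    have hs : ContDiff ℝ (⊤ : ℕ∞) (fun z : Jt V W (n + 1) × Tang V (n + 1) =>
        (jshift n z.1 (Tang.baseL V n (pr2 z.2)), pr2 z.2)) :=
      ((contDiff_jshift n).comp (contDiff_fst.prodMk (hb.comp hp2))).prodMk hp2
    have hD : ContDiff ℝ (⊤ : ℕ∞) (fderiv ℝ Φ) := hΦ.fderiv_right (by simp)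
    refine ⟨fun z => (Φ (jtrunc n z.1, pr1 z.2), fderiv ℝ Φ (jtrunc n z.1, pr1 z.2)
      (jshift n z.1 (Tang.baseL V n (pr2 z.2)), pr2 z.2)), ?_, ?_⟩
    · exact (hΦ.comp hj).prodMk ((hD.comp hj).clm_apply hs)
    · rintro p hp
      have hp' : Tang.baseL V n (pr1 p) ∈ U := by
        rw [Tang.baseL_apply] at hp ⊢
        exact hp
      have hbb : Tang.baseL V (n + 1) p = Tang.baseL V n (pr1 p) := by
        rw [Tang.baseL_apply, Tang.baseL_apply]; rfl
      rw [hbb]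
      obtain ⟨L, hL, hL'⟩ := hasFDerivAt_jet f n (Tang.baseL V n (pr1 p))
        fun k hk => h k (by omega) _ hp'
      refine Prod.ext (hf _ hp') ?_
      have h1 : HasFDerivAt (fun q => (jet f n (Tang.baseL V n q), q))
          ((L.comp (Tang.baseL V n)).prod (ContinuousLinearMap.id ℝ _)) (pr1 p) :=
        (hL.comp (pr1 p) (Tang.baseL V n).hasFDerivAt).prodMk (hasFDerivAt_id _)
      have h2 := HasFDerivAt.comp (f := fun q => (jet f n (Tang.baseL V n q), q)) (pr1 p)
        (hΦ.differentiable (by simp) (jet f n (Tang.baseL V n (pr1 p)), pr1 p)).hasFDerivAt h1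
      have h3 : TMap f n =ᶠ[nhds (pr1 p)] (Φ ∘ fun q => (jet f n (Tang.baseL V n q), q)) := by
        filter_upwards [(hU.preimage (Tang.baseL V n).continuous).mem_nhds hp'] with q hq
        exact hf q hq
      change fderiv ℝ (TMap f n) (pr1 p) (pr2 p) = _
      rw [h3.fderiv_eq, h2.fderiv]
      simp [hL']
      rfl

theorem TMap_differentiableAt (f : V → W) (U : Set V) (hU : IsOpen U) (n : ℕ)
    (h : ∀ k < n + 1, ∀ x ∈ U, DifferentiableAt ℝ (iteratedFDeriv ℝ k f) x)
    (p : Tang V n) (hp : Tang.baseL V n p ∈ U) : DifferentiableAt ℝ (TMap f n) p := by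
  obtain ⟨Φ, hΦ, hf⟩ := TMap_jet f U hU n fun k hk => h k (by omega)
  obtain ⟨L, hL, -⟩ := hasFDerivAt_jet f n (Tang.baseL V n p) fun k hk => h k (by omega) _ hp
  have h1 := (hL.comp p (Tang.baseL V n).hasFDerivAt).prodMk (hasFDerivAt_id p)
  have h2 := HasFDerivAt.comp (f := fun q => (jet f n (Tang.baseL V n q), q)) p
    (hΦ.differentiable (by simp) (jet f n (Tang.baseL V n p), p)).hasFDerivAt h1
  have h3 : TMap f n =ᶠ[nhds p] (Φ ∘ fun q => (jet f n (Tang.baseL V n q), q)) := by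
    filter_upwards [(hU.preimage (Tang.baseL V n).continuous).mem_nhds hp] with q hq
    exact hf q hq
  exact (h2.congr_of_eventuallyEq h3).differentiableAt

theorem last_TMap_tv (f : V → W) (U : Set V) (hU : IsOpen U) (n : ℕ)
    (h : ∀ k < n, ∀ x ∈ U, DifferentiableAt ℝ (iteratedFDeriv ℝ k f) x) (x : V) (hx : x ∈ U)
    (w : Fin n → V) :
    Tang.last W n (TMap f n (Tang.tv n x w)) = iteratedFDeriv ℝ n f x w := by
  induction n generalizing x with
  | zero => rfl
  | succ n ih =>
    have hd : DifferentiableAt ℝ (TMap f n) (Tang.tv n x (Fin.tail w)) :=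
      TMap_differentiableAt f U hU n h _ (by rw [Tang.baseL_apply, Tang.base_tv]; exact hx)
    have h1 := (Tang.last W n).hasFDerivAt.comp x
      (hd.hasFDerivAt.comp x (Tang.hasFDerivAt_tv n x (Fin.tail w)))
    have h2 : (fun y => iteratedFDeriv ℝ n f y (Fin.tail w)) =ᶠ[nhds x]
        (Tang.last W n ∘ (TMap f n ∘ fun y => Tang.tv n y (Fin.tail w))) := by
      filter_upwards [hU.mem_nhds hx] with y hy
      exact (ih (fun k hk => h k (by omega)) y hy (Fin.tail w)).symm
    have h3 := (h1.congr_of_eventuallyEq h2).fderiv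
    have h4 := ((ContinuousMultilinearMap.apply ℝ (fun _ : Fin n => V) W
      (Fin.tail w)).hasFDerivAt.comp x (h n (by omega) x hx).hasFDerivAt).fderiv
    have h5 := h4.symm.trans h3
    rw [iteratedFDeriv_succ_apply_left]
    exact (DFunLike.congr_fun h5 (w 0)).symm

end aux

/-- For an `ℓ`-times Fréchet differentiable map `f` on an open set, the
norm of the `ℓ`-th differential at `v₀` is bounded by the supremum of the fiber norms of
`T^ℓ f (v̲)` over all higher tangent vectors `v̲` with base point `v₀` and fiber norm `≤ 1`
(stated here as: every upper bound `M` of these fiber norms bounds `‖D^ℓ f (v₀)‖`). -/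
theorem stmt_5 {V : Type u} {W : Type v}
    [NormedAddCommGroup V] [NormedSpace ℝ V] [NormedAddCommGroup W] [NormedSpace ℝ W]
    (ℓ : ℕ) (hℓ : 1 ≤ ℓ) (VV : Set V) (hVV : IsOpen VV) (f : V → W)
    (hdiff : ∀ k < ℓ, ∀ x ∈ VV, DifferentiableAt ℝ (iteratedFDeriv ℝ k f) x)
    (v₀ : V) (hv₀ : v₀ ∈ VV) (M : ℝ)
    (hM : ∀ v : Tang V ℓ, Tang.base ℓ v = v₀ → Tang.fiberNorm ℓ v ≤ 1 →
      Tang.fiberNorm ℓ (TMap f ℓ v) ≤ M) :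
    ‖iteratedFDeriv ℝ ℓ f v₀‖ ≤ M := by
  have key : ∀ w : Fin ℓ → V, (∀ i, ‖w i‖ ≤ 1) → ‖iteratedFDeriv ℝ ℓ f v₀ w‖ ≤ M := by
    intro w hw
    rw [← last_TMap_tv f VV hVV ℓ hdiff v₀ hv₀ w]
    refine le_trans ?_ (hM (Tang.tv ℓ v₀ w) (Tang.base_tv ℓ v₀ w) (Tang.fiberNorm_tv ℓ v₀ w hw))
    obtain ⟨n, rfl⟩ : ∃ n, ℓ = n + 1 := ⟨ℓ - 1, by omega⟩
    exact (Tang.norm_last_le n _).trans (le_max_right _ _)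
  have hM0 : 0 ≤ M := (norm_nonneg _).trans (key 0 (by simp))
  refine ContinuousMultilinearMap.opNorm_le_bound hM0 fun w => ?_
  by_cases hw : ∃ i, w i = 0
  · obtain ⟨i, hi⟩ := hw
    rw [ContinuousMultilinearMap.map_coord_zero _ i hi, norm_zero]
    positivity
  · push Not at hw
    have h1 : w = fun i => ‖w i‖ • (‖w i‖⁻¹ • w i) := by
      funext i
      rw [smul_smul, mul_inv_cancel₀ (norm_ne_zero_iff.2 (hw i)), one_smul]
    have h2 := key (fun i => ‖w i‖⁻¹ • w i) fun i => by
      rw [norm_smul, norm_inv, norm_norm, inv_mul_cancel₀ (norm_ne_zero_iff.2 (hw i))]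
    have h3 : iteratedFDeriv ℝ ℓ f v₀ w =
        (∏ i, ‖w i‖) • iteratedFDeriv ℝ ℓ f v₀ (fun i => ‖w i‖⁻¹ • w i) := by
      conv_lhs => rw [h1]
      exact ContinuousMultilinearMap.map_smul_univ _ _ _
    rw [h3, norm_smul, Real.norm_of_nonneg (by positivity), mul_comm]
    gcongr

end
end

section
/- Let (W̄, ‖·‖) be a real Banach space, V_W ⊆ W̄ an open subset containing 0, C and K finite dimensional normed real vector spaces, V_K ⊆ K an open subset, and G : V_K × V_W → C × W̄ a continuous map of the form G(k, w) = (A(k, w), w − B(k, w)), where A : V_K × V_W → C and B : V_K × V_W → W̄, and where θ ∈ (0,1) and δ > 0 are such that the closed ball {w : ‖w‖ ≤ δ} is contained in V_W, ‖B(k, w') − B(k, w)‖ ≤ θ ‖w' − w‖ whenever ‖w‖ ≤ δ and ‖w'‖ ≤ δ, and ‖B(k, 0)‖ < (1 − θ) δ for all k ∈ V_K. Let σ : V_K → V_W be the solution map assigning to each k the unique fixed point σ(k) of B(k, ·) with ‖σ(k)‖ < δ. Define f : V_K → C by f(k) = A(k, σ(k)) and φ : f^{-1}(0) → V_K × V_W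 by φ(k) = (k, σ(k)). Then f is continuous, G^{-1}(0, 0) ∩ {(k, w) : ‖w‖ < δ} = {φ(k) : k ∈ f^{-1}(0)}, and φ is a homeomorphism from f^{-1}(0) onto this set. If moreover G is C^ℓ for some ℓ ≥ 1, then f is C^ℓ. -/
/-- Finite dimensional reduction for a map of the form
`G(k, w) = (A(k, w), w − B(k, w))` whose second component is a parametrized contraction:
with `σ` the solution map and `f(k) = A(k, σ(k))`, `φ(k) = (k, σ(k))`, the map `f` is
continuous, the set `G⁻¹(0, 0) ∩ {‖w‖ < δ}` equals `φ(f⁻¹(0))`, `φ` is a homeomorphism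
from `f⁻¹(0)` onto this set (it is continuous and bijective onto it, and its inverse is the
restriction of the continuous projection `Prod.fst`), and if `G` is `C^ℓ` (`ℓ ≥ 1`), then
`f` is `C^ℓ`. -/
theorem stmt_19
    {W : Type*} [NormedAddCommGroup W] [NormedSpace ℝ W] [CompleteSpace W]
    {C K : Type*} [NormedAddCommGroup C] [NormedSpace ℝ C] [FiniteDimensional ℝ C]
    [NormedAddCommGroup K] [NormedSpace ℝ K] [FiniteDimensional ℝ K]
    (VW : Set W) (hVWopen : IsOpen VW) (hVW0 : (0 : W) ∈ VW)
    (VK : Set K) (hVK : IsOpen VK)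
    (A : K × W → C) (B : K × W → W)
    (hGcont : ContinuousOn (fun p : K × W => ((A p, p.2 - B p) : C × W)) (VK ×ˢ VW))
    (θ δ : ℝ) (hθ0 : 0 < θ) (hθ1 : θ < 1) (hδ : 0 < δ)
    (hball : Metric.closedBall (0 : W) δ ⊆ VW)
    (hcontr : ∀ k ∈ VK, ∀ (w w' : W), ‖w‖ ≤ δ → ‖w'‖ ≤ δ →
      ‖B (k, w') - B (k, w)‖ ≤ θ * ‖w' - w‖)
    (hsmall : ∀ k ∈ VK, ‖B (k, 0)‖ < (1 - θ) * δ)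
    (σ : K → W) (hσfix : ∀ k ∈ VK, B (k, σ k) = σ k) (hσnorm : ∀ k ∈ VK, ‖σ k‖ < δ) :
    ContinuousOn (fun k => A (k, σ k)) VK ∧
      {p : K × W | p.1 ∈ VK ∧ p.2 ∈ VW ∧ ((A p, p.2 - B p) : C × W) = 0 ∧ ‖p.2‖ < δ} =
        (fun k => ((k, σ k) : K × W)) '' {k : K | k ∈ VK ∧ A (k, σ k) = 0} ∧
      Set.BijOn (fun k => ((k, σ k) : K × W)) {k : K | k ∈ VK ∧ A (k, σ k) = 0}
        {p : K × W | p.1 ∈ VK ∧ p.2 ∈ VW ∧ ((A p, p.2 - B p) : C × W) = 0 ∧ ‖p.2‖ < δ} ∧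
      ContinuousOn (fun k => ((k, σ k) : K × W)) {k : K | k ∈ VK ∧ A (k, σ k) = 0} ∧
      ∀ ℓ : ℕ, 1 ≤ ℓ →
        ContDiffOn ℝ ℓ (fun p : K × W => ((A p, p.2 - B p) : C × W)) (VK ×ˢ VW) →
        ContDiffOn ℝ ℓ (fun k => A (k, σ k)) VK := by
  have : CompleteSpace K := FiniteDimensional.complete ℝ K
  have hmem : ∀ k ∈ VK, (k, σ k) ∈ VK ×ˢ VW := fun k hk =>
    ⟨hk, hball (by simpa using (hσnorm k hk).le)⟩
  have hopen : IsOpen (VK ×ˢ VW) := hVK.prod hVWopen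
  have hA : ContinuousOn A (VK ×ˢ VW) := hGcont.fst
  have hB : ContinuousOn B (VK ×ˢ VW) := by
    have h := (continuousOn_snd (s := VK ×ˢ VW)).sub hGcont.snd
    refine h.congr fun p _ => ?_
    simp
  have hσ : ContinuousOn σ VK := by
    intro k₀ hk₀
    have hc : ContinuousWithinAt (fun k => B (k, σ k₀)) VK k₀ := by
      have h1 := hB (k₀, σ k₀) (hmem k₀ hk₀)
      refine ContinuousWithinAt.comp (f := fun k => (k, σ k₀)) (t := VK ×ˢ VW) h1
        (by fun_prop) ?_
      intro k hk
      exact ⟨hk, (hmem k₀ hk₀).2⟩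
    have hc' : Filter.Tendsto (fun k => (1 - θ)⁻¹ * ‖B (k, σ k₀) - σ k₀‖)
        (nhdsWithin k₀ VK) (nhds 0) := by
      have h2 := ((hc.tendsto.sub_const (σ k₀)).norm).const_mul (1 - θ)⁻¹
      simpa [hσfix k₀ hk₀] using h2
    refine tendsto_iff_norm_sub_tendsto_zero.2
      (squeeze_zero' (Filter.Eventually.of_forall fun k => norm_nonneg _) ?_ hc')
    filter_upwards [self_mem_nhdsWithin] with k hk
    have h3 := hcontr k hk (σ k₀) (σ k) (hσnorm k₀ hk₀).le (hσnorm k hk).le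
    rw [hσfix k hk] at h3
    have h4 : ‖σ k - σ k₀‖ ≤ ‖σ k - B (k, σ k₀)‖ + ‖B (k, σ k₀) - σ k₀‖ :=
      norm_sub_le_norm_sub_add_norm_sub _ _ _
    rw [inv_mul_eq_div, le_div_iff₀ (by linarith)]
    nlinarith
  have hφ : ContinuousOn (fun k => ((k, σ k) : K × W)) VK := continuousOn_id.prodMk hσ
  have hset : {p : K × W | p.1 ∈ VK ∧ p.2 ∈ VW ∧ ((A p, p.2 - B p) : C × W) = 0 ∧ ‖p.2‖ < δ} =
        (fun k => ((k, σ k) : K × W)) '' {k : K | k ∈ VK ∧ A (k, σ k) = 0} := by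
    ext ⟨k, w⟩
    simp only [Set.mem_setOf_eq, Set.mem_image, Prod.mk.injEq, Prod.mk_eq_zero]
    constructor
    · rintro ⟨hk, hw, ⟨hA0, hB0⟩, hn⟩
      have h3 := hcontr k hk (σ k) w (hσnorm k hk).le hn.le
      rw [hσfix k hk, ← sub_eq_zero.1 hB0] at h3
      have h5 : ‖w - σ k‖ = 0 := by nlinarith [norm_nonneg (w - σ k)]
      have h6 : w = σ k := sub_eq_zero.1 (norm_eq_zero.1 h5)
      subst h6
      exact ⟨k, ⟨hk, hA0⟩, rfl, rfl⟩
    · rintro ⟨k', ⟨hk, hA0⟩, rfl, rfl⟩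
      exact ⟨hk, (hmem _ hk).2, ⟨hA0, by rw [hσfix _ hk, sub_self]⟩, hσnorm _ hk⟩
  refine ⟨hA.comp hφ hmem, hset, ?_, hφ.mono fun k hk => hk.1, ?_⟩
  · rw [hset]
    exact Set.InjOn.bijOn_image fun a _ b _ h => (Prod.mk.inj h).1
  intro ℓ hℓ hG
  have hφd : ContDiffOn ℝ ℓ (fun k => ((k, σ k) : K × W)) VK := by
    refine contDiffOn_id.prodMk ?_
    intro k₀ hk₀
    refine ContDiffAt.contDiffWithinAt ?_
    have hn : VK ×ˢ VW ∈ nhds (k₀, σ k₀) := hopen.mem_nhds (hmem k₀ hk₀)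
    have hF : ContDiffAt ℝ ℓ (fun p : K × W => p.2 - B p) (k₀, σ k₀) :=
      ((hG _ (hmem k₀ hk₀)).contDiffAt hn).snd
    have pn : (ℓ : WithTop ℕ∞) ≠ 0 := by
      have : ℓ ≠ 0 := by omega
      exact_mod_cast this
    have hFd := (hF.differentiableAt pn).hasFDerivAt
    set L := fderiv ℝ (fun p : K × W => p.2 - B p) (k₀, σ k₀) with hL
    have hinv : (L ∘L .inr ℝ K W).IsInvertible := by
      have hin : HasFDerivAt (fun w : W => ((k₀, w) : K × W)) (.inr ℝ K W) (σ k₀) :=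
        hasFDerivAt_prodMk_right k₀ (σ k₀)
      have h1 : HasFDerivAt (fun w : W => w - B (k₀, w)) (L ∘L .inr ℝ K W) (σ k₀) :=
        HasFDerivAt.comp (g := fun p : K × W => p.2 - B p) (σ k₀) hFd hin
      have h2 : HasFDerivAt (fun w : W => B (k₀, w))
          (ContinuousLinearMap.id ℝ W - L ∘L .inr ℝ K W) (σ k₀) := by
        have h := (hasFDerivAt_id (𝕜 := ℝ) (σ k₀)).sub h1
        refine h.congr_of_eventuallyEq (Filter.Eventually.of_forall fun w => ?_)
        simp
      have h3 : ‖ContinuousLinearMap.id ℝ W - L ∘L .inr ℝ K W‖ ≤ θ := by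
        refine h2.le_of_lip' hθ0.le ?_
        have : Metric.ball (0 : W) δ ∈ nhds (σ k₀) :=
          Metric.isOpen_ball.mem_nhds (by simpa using hσnorm k₀ hk₀)
        filter_upwards [this] with w hw
        exact hcontr k₀ hk₀ (σ k₀) w (hσnorm k₀ hk₀).le (mem_ball_zero_iff.1 hw).le
      have h4 := isUnit_one_sub_of_norm_lt_one (R := W →L[ℝ] W) (lt_of_le_of_lt h3 hθ1)
      have h5 : (1 : W →L[ℝ] W) - (ContinuousLinearMap.id ℝ W - L ∘L .inr ℝ K W)
          = L ∘L .inr ℝ K W := sub_sub_cancel _ _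
      rw [h5] at h4
      obtain ⟨u, hu⟩ := h4
      exact ⟨ContinuousLinearEquiv.ofUnit u, by rw [← hu]; rfl⟩
    have hcd := hF.contDiffAt_implicitFunction pn hinv
    refine hcd.congr_of_eventuallyEq ?_
    have hev := hF.eventually_apply_eq_iff_implicitFunction pn hinv
    have hcσ : ContinuousAt (fun k => ((k, σ k) : K × W)) k₀ :=
      hφ.continuousAt (hVK.mem_nhds hk₀)
    filter_upwards [hcσ.eventually hev, hVK.mem_nhds hk₀] with k hk hkV
    refine (hk.1 ?_).symm
    simp [hσfix k hkV, hσfix k₀ hk₀]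
  have hAd : ContDiffOn ℝ ℓ A (VK ×ˢ VW) := hG.fst
  exact hAd.comp hφd hmem
end
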